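/- Let M be a finite automatic algebra with Q ≠ ∅ and suppose some letter a ∈ Σ is totally undefined, i.e., q·a = 0 for all q ∈ Q. Let N be the submagma of M on M ∖ {a}. Then there is an injective multiplication-preserving map from M into N × N; explicitly, for any fixed q ∈ Q, the map φ with φ(x) = (x, 0) for x ∈ N and φ(a) = (0, q) is such an embedding. Consequently every magma embeds into a power of M if and only if it embeds into a power of N. -/

import Mathlib

/-- The multiplication of an automatic algebra with state set `Q`, letter set `S`,
zero element `none`, and partial transition function `δ`. -/
def autMul {Q S : Type} (δ : Q → S → Option Q) :
    Option (Q ⊕ S) → Option (Q ⊕ S) → Option (Q ⊕ S)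
  | some (Sum.inl q), some (Sum.inr a) => (δ q a).map Sum.inl
  | _, _ => none

/-- A magma `(B, mB)` embeds into some power of a magma `(C, mC)`. -/
def EmbedsInPower {B C : Type} (mB : B → B → B) (mC : C → C → C) : Prop :=
  ∃ (I : Type) (g : B → I → C), Function.Injective g ∧
    ∀ x y : B, g (mB x y) = fun i => mC (g x i) (g y i)

open scoped Classical in
/-- The explicit map `φ : M → N × N` where `N = M ∖ {a}`:
`φ x = (x, 0)` for `x ∈ N`, and `φ a = (0, q)`. -/
noncomputable def phiLetter {Q S : Type} (a : S) (q : Q) (x : Option (Q ⊕ S)) :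
    {v : Option (Q ⊕ S) // v ≠ some (Sum.inr a)} ×
      {v : Option (Q ⊕ S) // v ≠ some (Sum.inr a)} :=
  if h : x = some (Sum.inr a) then (⟨none, by simp⟩, ⟨some (Sum.inl q), by simp⟩)
  else (⟨x, h⟩, ⟨none, by simp⟩)

/-- Embeddability in powers is monotone along injective homomorphisms. -/
theorem EmbedsInPower.comp_injective {B C D : Type} {mB : B → B → B} {mC : C → C → C}
    {mD : D → D → D} (h : EmbedsInPower mB mC) (f : C → D) (hf : Function.Injective f)
    (hmul : ∀ x y, f (mC x y) = mD (f x) (f y)) : EmbedsInPower mB mD := by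
  obtain ⟨I, g, hg, hm⟩ := h
  refine ⟨I, fun b i => f (g b i), fun x y hxy => hg ?_, fun x y => ?_⟩
  · funext i
    exact hf (congrFun hxy i)
  · funext i
    simp only [hm, hmul]

/-- A magma embedding into a power of `C × C` embeds into a power of `C`. -/
theorem EmbedsInPower.of_prod_self {B C : Type} {mB : B → B → B} {mC : C → C → C}
    (h : EmbedsInPower mB fun u v : C × C => (mC u.1 v.1, mC u.2 v.2)) :
    EmbedsInPower mB mC := by
  obtain ⟨I, g, hg, hm⟩ := h
  refine ⟨I ⊕ I, fun b => Sum.elim (fun i => (g b i).1) (fun i => (g b i).2),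
    fun x y hxy => hg ?_, fun x y => ?_⟩
  · funext i
    exact Prod.ext (congrFun hxy (Sum.inl i)) (congrFun hxy (Sum.inr i))
  · funext i
    cases i <;> simp [hm]

theorem autMul_ne_letter {Q S : Type} (δ : Q → S → Option Q) (a : S)
    (x y : Option (Q ⊕ S)) : autMul δ x y ≠ some (Sum.inr a) := by
  rcases x with _ | x | x <;> rcases y with _ | y | y <;> simp [autMul]

@[simp]
theorem autMul_none_left {Q S : Type} (δ : Q → S → Option Q) (y : Option (Q ⊕ S)) :
    autMul δ none y = none := by
  simp [autMul]

@[simp]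
theorem autMul_none_right {Q S : Type} (δ : Q → S → Option Q) (x : Option (Q ⊕ S)) :
    autMul δ x none = none := by
  simp [autMul]

@[simp]
theorem autMul_letter_left {Q S : Type} (δ : Q → S → Option Q) (b : S)
    (y : Option (Q ⊕ S)) : autMul δ (some (Sum.inr b)) y = none := by
  simp [autMul]

@[simp]
theorem autMul_state_right {Q S : Type} (δ : Q → S → Option Q) (x : Option (Q ⊕ S))
    (q : Q) : autMul δ x (some (Sum.inl q)) = none := by
  simp [autMul]

theorem autMul_undefined_letter_right {Q S : Type} {δ : Q → S → Option Q} {a : S}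
    (ha : ∀ q : Q, δ q a = none) (x : Option (Q ⊕ S)) :
    autMul δ x (some (Sum.inr a)) = none := by
  rcases x with _ | x | x <;> simp [autMul, ha]

theorem phiLetter_injective {Q S : Type} (a : S) (q : Q) :
    Function.Injective (phiLetter a q) := by
  intro x y hxy
  by_cases hx : x = some (Sum.inr a) <;> by_cases hy : y = some (Sum.inr a) <;>
    simp_all [phiLetter]

/-- Multiplication on the submagma obtained by removing the letter `a`. -/
def removeLetterMul {Q S : Type} (δ : Q → S → Option Q) (a : S)
    (x y : {v : Option (Q ⊕ S) // v ≠ some (Sum.inr a)}) :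
    {v : Option (Q ⊕ S) // v ≠ some (Sum.inr a)} :=
  ⟨autMul δ x y, autMul_ne_letter δ a x y⟩

theorem phiLetter_autMul {Q S : Type} {δ : Q → S → Option Q} {a : S}
    (ha : ∀ q : Q, δ q a = none) (q : Q) (x y : Option (Q ⊕ S)) :
    phiLetter a q (autMul δ x y) =
      (removeLetterMul δ a (phiLetter a q x).1 (phiLetter a q y).1,
       removeLetterMul δ a (phiLetter a q x).2 (phiLetter a q y).2) := by
  by_cases hx : x = some (Sum.inr a) <;> by_cases hy : y = some (Sum.inr a) <;>
    simp [phiLetter, removeLetterMul, autMul_ne_letter, autMul_undefined_letter_right ha, hx, hy]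

/-- Let `M` be a finite automatic algebra with `Q ≠ ∅` in which the letter `a` is totally
undefined, and let `N` be the submagma of `M` on `M ∖ {a}` (so there is a multiplication
`nmul` on `N` restricting that of `M`).  Then for any fixed state `q`, the explicit map
`φ` with `φ x = (x, 0)` for `x ∈ N` and `φ a = (0, q)` is an injective
multiplication-preserving map from `M` into `N × N`; consequently every magma embeds into
a power of `M` iff it embeds into a power of `N`. -/
theorem remove_totally_undefined_letter
    {Q S : Type} [Fintype Q] [Fintype S] [Nonempty Q]
    (δ : Q → S → Option Q) (a : S) (ha : ∀ q : Q, δ q a = none) (q : Q) :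
    ∃ nmul : {v : Option (Q ⊕ S) // v ≠ some (Sum.inr a)} →
        {v : Option (Q ⊕ S) // v ≠ some (Sum.inr a)} →
        {v : Option (Q ⊕ S) // v ≠ some (Sum.inr a)},
      (∀ x y, (nmul x y : Option (Q ⊕ S)) = autMul δ (x : Option (Q ⊕ S)) y) ∧
      Function.Injective (phiLetter a q) ∧
      (∀ x y : Option (Q ⊕ S),
        phiLetter a q (autMul δ x y) =
          (nmul (phiLetter a q x).1 (phiLetter a q y).1,
           nmul (phiLetter a q x).2 (phiLetter a q y).2)) ∧
      ∀ (B : Type) (mB : B → B → B),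
        EmbedsInPower mB (autMul δ) ↔ EmbedsInPower mB nmul := by
  refine ⟨removeLetterMul δ a, fun _ _ => rfl, phiLetter_injective a q,
    phiLetter_autMul ha q, fun B mB => ⟨fun h => ?_, fun h => ?_⟩⟩
  · exact (h.comp_injective (phiLetter a q) (phiLetter_injective a q)
      (phiLetter_autMul ha q)).of_prod_self
  · exact h.comp_injective Subtype.val Subtype.val_injective fun _ _ => rfl
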